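/- Let A ∈ ℂ^{n₁×n₁×n₃} with ind(A) = k ≥ 1, let A^{GD} be a GD inverse of A, let A† be the Moore–Penrose inverse of A, and set A^{GD,*} = A^{GD} ⋆ A ⋆ A*. Then: (a) A ⋆ A^{GD,*} ⋆ (A†)* = A; (b) A† ⋆ A ⋆ A^{GD,*} = A*; (c) A^k ⋆ A^{GD,*} ⋆ (A†)* = A^k and A^{GD,*} ⋆ (A†)* ⋆ A^k = A^k; (d) A† ⋆ A ⋆ (A^{GD,*})² = A* ⋆ A^{GD,*} and A† ⋆ A ⋆ (A^{GD,*})² ⋆ A ⋆ A† = A* ⋆ A^{GD,*}; (e) (A ⋆ A^{GD,*})* = A ⋆ A^{GD,*}; (f) (A†)* ⋆ A^{GD,*} ⋆ (A†)* = (A†)*. -/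

import Mathlib

open Matrix BigOperators

/-- A third-order complex tensor in `ℂ^{n₁ × n₂ × n₃}`, given by its frontal slices. -/
abbrev Tensor3 (n₁ n₂ n₃ : ℕ) := Fin n₃ → Matrix (Fin n₁) (Fin n₂) ℂ

/-- Mode-3 product of a tensor with an `n₃ × n₃` matrix: the slices of the result are the
indicated linear combinations of the slices of `A`. -/
noncomputable def mode3 {n₁ n₂ n₃ : ℕ} (M : Matrix (Fin n₃) (Fin n₃) ℂ) (A : Tensor3 n₁ n₂ n₃) :
    Tensor3 n₁ n₂ n₃ :=
  fun i => ∑ j, M i j • A j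

/-- The M-product `A ⋆_M B`: slice-wise matrix product in the transformed (hat) domain,
transformed back by `M⁻¹`. -/
noncomputable def mprod {n₁ n₂ l n₃ : ℕ} (M : Matrix (Fin n₃) (Fin n₃) ℂ)
    (A : Tensor3 n₁ n₂ n₃) (B : Tensor3 n₂ l n₃) : Tensor3 n₁ l n₃ :=
  mode3 M⁻¹ (fun i => mode3 M A i * mode3 M B i)

/-- The identity tensor: every slice of its mode-3 transform is the identity matrix. -/
noncomputable def idT (n₁ : ℕ) {n₃ : ℕ} (M : Matrix (Fin n₃) (Fin n₃) ℂ) : Tensor3 n₁ n₁ n₃ :=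
  mode3 M⁻¹ (fun _ => (1 : Matrix (Fin n₁) (Fin n₁) ℂ))

/-- Powers of a square tensor with respect to the M-product. -/
noncomputable def mpow {n₁ n₃ : ℕ} (M : Matrix (Fin n₃) (Fin n₃) ℂ) (A : Tensor3 n₁ n₁ n₃) :
    ℕ → Tensor3 n₁ n₁ n₃
  | 0 => idT n₁ M
  | k + 1 => mprod M (mpow M A k) A

/-- Conjugate transpose with respect to the M-product: slice-wise conjugate transpose in the
transformed domain. -/
noncomputable def ctrans {n₁ n₂ n₃ : ℕ} (M : Matrix (Fin n₃) (Fin n₃) ℂ) (A : Tensor3 n₁ n₂ n₃) :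
    Tensor3 n₂ n₁ n₃ :=
  mode3 M⁻¹ (fun i => (mode3 M A i)ᴴ)

/-- Index of a square complex matrix: the least `k ≥ 0` with `rank(B^k) = rank(B^{k+1})`. -/
noncomputable def matIndex {n : ℕ} (B : Matrix (Fin n) (Fin n) ℂ) : ℕ :=
  sInf {k : ℕ | (B ^ k).rank = (B ^ (k + 1)).rank}

/-- Index of a tensor: the maximum of the indices of the slices of its mode-3 transform. -/
noncomputable def tIndex {n₁ n₃ : ℕ} (M : Matrix (Fin n₃) (Fin n₃) ℂ)
    (A : Tensor3 n₁ n₁ n₃) : ℕ :=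
  Finset.univ.sup fun i => matIndex (mode3 M A i)

/-- `X` is a GD inverse of `A` with exponent `k`:
`A ⋆ X ⋆ A = A`, `X ⋆ A^{k+1} = A^k`, `A^{k+1} ⋆ X = A^k`. -/
def IsGD {n₁ n₃ : ℕ} (M : Matrix (Fin n₃) (Fin n₃) ℂ) (A X : Tensor3 n₁ n₁ n₃)
    (k : ℕ) : Prop :=
  mprod M (mprod M A X) A = A ∧
  mprod M X (mpow M A (k + 1)) = mpow M A k ∧
  mprod M (mpow M A (k + 1)) X = mpow M A k

/-- `X` is the Drazin inverse of `A` with exponent `k`. -/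
def IsDrazin {n₁ n₃ : ℕ} (M : Matrix (Fin n₃) (Fin n₃) ℂ) (A X : Tensor3 n₁ n₁ n₃)
    (k : ℕ) : Prop :=
  mprod M X (mpow M A (k + 1)) = mpow M A k ∧
  mprod M (mprod M X A) X = X ∧
  mprod M X A = mprod M A X

/-- `X` is the Moore–Penrose inverse of `A`. -/
def IsMP {n₁ n₃ : ℕ} (M : Matrix (Fin n₃) (Fin n₃) ℂ) (A X : Tensor3 n₁ n₁ n₃) : Prop :=
  mprod M (mprod M A X) A = A ∧
  mprod M (mprod M X A) X = X ∧
  ctrans M (mprod M A X) = mprod M A X ∧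
  ctrans M (mprod M X A) = mprod M X A

theorem mode3_mode3 {n₁ n₂ n₃ : ℕ} (M N : Matrix (Fin n₃) (Fin n₃) ℂ) (A : Tensor3 n₁ n₂ n₃) :
    mode3 M (mode3 N A) = mode3 (M * N) A := by
  funext i
  simp only [mode3, Matrix.mul_apply, Finset.smul_sum, Finset.sum_smul, smul_smul]
  exact Finset.sum_comm

theorem mode3_one {n₁ n₂ n₃ : ℕ} (A : Tensor3 n₁ n₂ n₃) : mode3 1 A = A := by
  funext i
  simp [mode3, Matrix.one_apply]

section Transform

variable {n₁ n₂ n₃ : ℕ} {M : Matrix (Fin n₃) (Fin n₃) ℂ}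

theorem mode3_injective (hM : IsUnit M) :
    Function.Injective (mode3 M : Tensor3 n₁ n₂ n₃ → Tensor3 n₁ n₂ n₃) :=
  Function.LeftInverse.injective (g := mode3 M⁻¹) fun A => by
    rw [mode3_mode3, Matrix.nonsing_inv_mul M ((Matrix.isUnit_iff_isUnit_det M).1 hM), mode3_one]

theorem mode3_mode3_inv (hM : IsUnit M) (A : Tensor3 n₁ n₂ n₃) : mode3 M (mode3 M⁻¹ A) = A := by
  rw [mode3_mode3, Matrix.mul_nonsing_inv M ((Matrix.isUnit_iff_isUnit_det M).1 hM), mode3_one]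

theorem mode3_mprod (hM : IsUnit M) (A B : Tensor3 n₁ n₁ n₃) :
    mode3 M (mprod M A B) = mode3 M A * mode3 M B :=
  mode3_mode3_inv hM _

theorem mode3_ctrans (hM : IsUnit M) (A : Tensor3 n₁ n₁ n₃) :
    mode3 M (ctrans M A) = star (mode3 M A) :=
  mode3_mode3_inv hM _

theorem mode3_mpow (hM : IsUnit M) (A : Tensor3 n₁ n₁ n₃) (k : ℕ) :
    mode3 M (mpow M A k) = mode3 M A ^ k := by
  induction k with
  | zero => exact mode3_mode3_inv hM _
  | succ k ih => rw [mpow, mode3_mprod hM, ih, pow_succ]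

end Transform

theorem pow_mul_inner_inverse_mul {R : Type*} [Monoid R] {a g : R} {k : ℕ} (hk : 1 ≤ k)
    (hg : a * g * a = a) : a ^ k * g * a = a ^ k := by
  obtain ⟨m, rfl⟩ := Nat.exists_eq_add_of_le' hk
  rw [pow_succ, mul_assoc, mul_assoc, ← mul_assoc a, hg]

section StarMonoid

variable {R : Type*} [Monoid R] [StarMul R] {a g p : R}

theorem mul_star_mul_star_eq_self (h₁ : a * p * a = a) (h₄ : star (p * a) = p * a) :
    a * star a * star p = a := by
  rw [mul_assoc, ← star_mul, h₄, ← mul_assoc, h₁]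

theorem mul_mul_star_eq_star (h₁ : a * p * a = a) (h₄ : star (p * a) = p * a) :
    p * a * star a = star a := by
  rw [← h₄, ← star_mul, ← mul_assoc, h₁]

theorem star_mul_mul_eq_star (h₁ : a * p * a = a) (h₃ : star (a * p) = a * p) :
    star a * a * p = star a := by
  rw [mul_assoc, ← h₃, ← star_mul, h₁]

theorem star_mul_inner_inverse_mul (hg : a * g * a = a) (h₂ : p * a * p = p)
    (h₄ : star (p * a) = p * a) : star p * g * a = star p := by
  have hp : star p * (p * a) = star p := by rw [← h₄, ← star_mul, h₂]
  calc star p * g * a = star p * (p * a) * g * a := by rw [hp]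
    _ = star p * (p * (a * g * a)) := by simp only [mul_assoc]
    _ = star p := by rw [hg, hp]

end StarMonoid

/-- properties (a)–(f) of the GD-Star inverse `A^{GD,*} = A^{GD} ⋆ A ⋆ A*`. -/
theorem gdstar_properties {n₁ n₃ : ℕ} (hn₁ : 0 < n₁) (hn₃ : 0 < n₃)
    (M : Matrix (Fin n₃) (Fin n₃) ℂ) (hM : IsUnit M)
    (A AGD Adag X : Tensor3 n₁ n₁ n₃) (k : ℕ) (hk : tIndex M A = k) (hk1 : 1 ≤ k)
    (hAGD : IsGD M A AGD k) (hAdag : IsMP M A Adag)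
    (hX : X = mprod M (mprod M AGD A) (ctrans M A)) :
    -- (a)
    (mprod M (mprod M A X) (ctrans M Adag) = A) ∧
    -- (b)
    (mprod M (mprod M Adag A) X = ctrans M A) ∧
    -- (c)
    (mprod M (mprod M (mpow M A k) X) (ctrans M Adag) = mpow M A k ∧
      mprod M (mprod M X (ctrans M Adag)) (mpow M A k) = mpow M A k) ∧
    -- (d)
    (mprod M (mprod M (mprod M Adag A) X) X = mprod M (ctrans M A) X ∧
      mprod M (mprod M (mprod M (mprod M (mprod M Adag A) X) X) A) Adag =
        mprod M (ctrans M A) X) ∧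
    -- (e)
    (ctrans M (mprod M A X) = mprod M A X) ∧
    -- (f)
    (mprod M (mprod M (ctrans M Adag) X) (ctrans M Adag) = ctrans M Adag) := by
  obtain ⟨hg, hgk, -⟩ := hAGD
  obtain ⟨h₁, h₂, h₃, h₄⟩ := hAdag
  subst hX
  apply_fun mode3 M at hg hgk h₁ h₂ h₃ h₄
  simp only [mode3_mprod hM, mode3_ctrans hM, mode3_mpow hM] at hg hgk h₁ h₂ h₃ h₄
  generalize ha : mode3 M A = a at hg hgk h₁ h₂ h₃ h₄
  generalize hg' : mode3 M AGD = g at hg hgk h₁ h₂ h₃ h₄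
  generalize hp : mode3 M Adag = p at hg hgk h₁ h₂ h₃ h₄
  have haX : a * (g * a * star a) = a * star a := by simp only [← mul_assoc, hg]
  have hXp : g * a * star a * star p = g * a := by
    rw [mul_assoc g, mul_assoc g, mul_star_mul_star_eq_self h₁ h₄]
  have hpaX : p * a * (g * a * star a) = star a := by
    rw [mul_assoc, haX, ← mul_assoc, mul_mul_star_eq_star h₁ h₄]
  have inj := mode3_injective (n₁ := n₁) (n₂ := n₁) hM
  refine ⟨inj ?_, inj ?_, ⟨inj ?_, inj ?_⟩, ⟨inj ?_, inj ?_⟩, inj ?_, inj ?_⟩ <;>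
    simp only [mode3_mprod hM, mode3_ctrans hM, mode3_mpow hM, ha, hg', hp]
  · rw [haX, mul_star_mul_star_eq_self h₁ h₄]
  · exact hpaX
  · rw [mul_assoc, hXp, ← mul_assoc, pow_mul_inner_inverse_mul hk1 hg]
  · rw [hXp, mul_assoc, ← pow_succ', hgk]
  · rw [hpaX]
  · have hXap : g * a * star a * a * p = g * a * star a := by
      rw [mul_assoc (g * a), mul_assoc (g * a), star_mul_mul_eq_star h₁ h₃]
    rw [hpaX, mul_assoc, mul_assoc, ← mul_assoc _ a p, hXap]
  · rw [haX, star_mul, star_star]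
  · rw [mul_assoc, hXp, ← mul_assoc, star_mul_inner_inverse_mul hg h₂ h₄]
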